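/- Bernstein-certificate criterion for local stability: Let f : R^n -> R^n be continuous with f(0) = 0 and let X = [-1/2, 1/2]^n. For each i let b_i(x) be the multivariate Bernstein polynomial (with prescribed degrees, in the variables shifted so that X corresponds to the unit cube) approximating f_i on X, and let epsbar_i >= 0 satisfy |f_i(x) - b_i(x)| <= epsbar_i for all x in X. Suppose there exist a polynomial V(x), positive definite polynomials phi_1(x) and phi_2(x), and nonnegative polynomials s_{1,i}, ..., s_{6,i} such that for all real x and all real scalars eps_1, ..., eps_n: (a) V(x) - phi_1(x) + sum over i of [ s_{1,i} (x_i - 1/2) - s_{2,i} (x_i + 1/2) ] >= 0, and (b) sum over i of [ - (partial V / partial x_i)(x) * ( b_i(x) + eps_i ) + s_{3,i} (eps_i - epsbar_i) - s_{4,i} (eps_i + epsbar_i) + s_{5,i} (x_i - 1/2) - s_{6,i} (x_i + 1/2) ] - phi_2(x) >= 0. Then the origin is a Lyapunov-stable equilibrium of x' = f(x) relative to X: for every epsilon > 0 there exists delta > 0 such that every differentiable solution x(t) of x'(t) = f(x(t)) with ||x(0)|| <= delta and x(t) in X for all t >= 0 satisfies ||x(t)|| <= epsilon for all t >= 0. 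-/

import Mathlib

open Finset

/-- Partial derivative of `g : ℝⁿ → ℝ` in the `j`-th coordinate direction. -/
noncomputable def pder {n : ℕ} (j : Fin n) (g : (Fin n → ℝ) → ℝ) : (Fin n → ℝ) → ℝ :=
  fun x => deriv (fun t : ℝ => g (Function.update x j t)) (x j)

/-- `g : ℝⁿ → ℝ` is a polynomial function. -/
def IsPolyFun {n : ℕ} (g : (Fin n → ℝ) → ℝ) : Prop :=
  ∃ q : MvPolynomial (Fin n) ℝ, ∀ x, g x = MvPolynomial.eval x q

/-- A positive definite (polynomial) function: vanishing at `0` and positive elsewhere. -/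
def IsPosDef {n : ℕ} (φ : (Fin n → ℝ) → ℝ) : Prop :=
  φ 0 = 0 ∧ ∀ x : Fin n → ℝ, x ≠ 0 → 0 < φ x

/-- The multivariate Bernstein polynomial with degrees `μ` of `g : ℝⁿ → ℝ`, in the
variables shifted so that the box `[-1/2, 1/2]ⁿ` corresponds to the unit cube. -/
noncomputable def bernShift {n : ℕ} (μ : Fin n → ℕ) (g : (Fin n → ℝ) → ℝ)
    (x : Fin n → ℝ) : ℝ :=
  ∑ kk ∈ Fintype.piFinset (fun j => Finset.range (μ j + 1)),
    g (fun j => (kk j : ℝ) / (μ j : ℝ) - 1 / 2) *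
      ∏ j, (((μ j).choose (kk j) : ℝ) * (x j + 1 / 2) ^ (kk j) *
        (1 / 2 - x j) ^ (μ j - kk j))

open Set in
/-- Along a trajectory whose Lyapunov derivative is at most `-c` on `[a, b]`, the function `V`
drops by at least `c * (b - a)`. -/
lemma le_sub_of_lyapunov_derivative_le {E : Type*} [NormedAddCommGroup E] [NormedSpace ℝ E]
    {f : E → E} {V : E → ℝ} (hV : Differentiable ℝ V) {x : ℝ → E} {a b c : ℝ} (hab : a ≤ b)
    (hx : ∀ t ∈ Icc a b, HasDerivAt x (f (x t)) t)
    (hdec : ∀ t ∈ Icc a b, fderiv ℝ V (x t) (f (x t)) ≤ -c) :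
    V (x b) ≤ V (x a) - c * (b - a) := by
  have hd : ∀ t ∈ Icc a b, HasDerivAt (fun t => V (x t)) (fderiv ℝ V (x t) (f (x t))) t :=
    fun t ht => (hV (x t)).hasFDerivAt.comp_hasDerivAt t (hx t ht)
  have := (convex_Icc a b).image_sub_le_mul_sub_of_deriv_le
    (fun t ht => (hd t ht).continuousAt.continuousWithinAt)
    (fun t ht => (hd t (interior_subset ht)).differentiableAt.differentiableWithinAt)
    (fun t ht => (hd t (interior_subset ht)).deriv.trans_le (hdec t (interior_subset ht)))
    a (left_mem_Icc.2 hab) b (right_mem_Icc.2 hab) hab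
  linarith

/-- A continuous function that is positive away from the origin is bounded below by a positive
constant on the part of a compact set lying outside a ball around the origin. -/
lemma IsCompact.exists_pos_le_of_le_norm {E : Type*} [NormedAddCommGroup E] {X : Set E}
    (hX : IsCompact X) {φ : E → ℝ} (hφ : Continuous φ) (hpos : ∀ x, x ≠ 0 → 0 < φ x)
    {r : ℝ} (hr : 0 < r) : ∃ c > 0, ∀ x ∈ X, r ≤ ‖x‖ → c ≤ φ x := by
  obtain ⟨c, hc, h⟩ := (hX.inter_right
    (isClosed_le continuous_const continuous_norm : IsClosed {x : E | r ≤ ‖x‖})).exists_forall_le'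
    hφ.continuousOn (a := 0) (fun x hx => hpos x (norm_pos_iff.1 (hr.trans_le hx.2)))
  exact ⟨c, hc, fun x hx hrx => h x ⟨hx, hrx⟩⟩

/-- If `V` strictly decreases along a trajectory that stays in a compact set, then `V` never
drops below its value at the origin. -/
lemma lyapunov_zero_le_of_forall_mem {E : Type*} [NormedAddCommGroup E] [NormedSpace ℝ E]
    {X : Set E} (hX : IsCompact X) {f : E → E} {V φ : E → ℝ} (hV : Differentiable ℝ V)
    (hφ : Continuous φ) (hφ0 : φ 0 = 0) (hpos : ∀ x, x ≠ 0 → 0 < φ x)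
    (hdec : ∀ x ∈ X, fderiv ℝ V x (f x) ≤ -φ x) {x : ℝ → E}
    (hx : ∀ t, 0 ≤ t → HasDerivAt x (f (x t)) t) (hxX : ∀ t, 0 ≤ t → x t ∈ X)
    {T : ℝ} (hT : 0 ≤ T) : V 0 ≤ V (x T) := by
  have hnn : ∀ y, 0 ≤ φ y := fun y => by
    rcases eq_or_ne y 0 with rfl | hy
    exacts [hφ0.ge, (hpos y hy).le]
  by_contra! hlt
  obtain ⟨r, hr, hball⟩ := Metric.eventually_nhds_iff.1
    (hV.continuous.continuousAt.eventually (lt_mem_nhds hlt) : ∀ᶠ y in nhds 0, V (x T) < V y)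
  have hfar : ∀ t, T ≤ t → r ≤ ‖x t‖ := fun t ht => by
    by_contra! hn
    have h1 := hball (y := x t) (by simpa using hn)
    have h2 := le_sub_of_lyapunov_derivative_le (c := 0) hV ht
      (fun s hs => hx s (hT.trans hs.1)) (fun s hs => by
        linarith [hdec _ (hxX s (hT.trans hs.1)), hnn (x s)])
    linarith
  obtain ⟨c, hc, hcφ⟩ := hX.exists_pos_le_of_le_norm hφ hpos hr
  obtain ⟨m, hm⟩ := (hX.image hV.continuous).bddBelow
  have hm' : ∀ t, 0 ≤ t → m ≤ V (x t) := fun t ht => hm ⟨_, hxX t ht, rfl⟩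
  have hle : T ≤ T + (V (x T) - m + 1) / c :=
    le_add_of_nonneg_right (div_nonneg (by linarith [hm' T hT]) hc.le)
  have h := le_sub_of_lyapunov_derivative_le (c := c) hV hle
    (fun s hs => hx s (hT.trans hs.1)) (fun s hs => by
      linarith [hdec _ (hxX s (hT.trans hs.1)),
        hcφ _ (hxX s (hT.trans hs.1)) (hfar s hs.1)])
  have hcancel : c * (T + (V (x T) - m + 1) / c - T) = V (x T) - m + 1 := by
    field_simp
    ring
  linarith [hm' _ (hT.trans hle)]

/-- **Lyapunov stability relative to a compact set.** No sign condition on `V` is required, since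
the trajectories considered stay in the compact set forever. -/
theorem lyapunov_stable_of_forall_mem {E : Type*} [NormedAddCommGroup E] [NormedSpace ℝ E]
    {X : Set E} (hX : IsCompact X) {f : E → E} (hf : Continuous f) {V φ : E → ℝ}
    (hV : Differentiable ℝ V)
    (hφ : Continuous φ) (hφ0 : φ 0 = 0) (hpos : ∀ x, x ≠ 0 → 0 < φ x)
    (hdec : ∀ x ∈ X, fderiv ℝ V x (f x) ≤ -φ x) {ε : ℝ} (hε : 0 < ε) :
    ∃ δ > (0 : ℝ), ∀ x : ℝ → E, (∀ t, 0 ≤ t → HasDerivAt x (f (x t)) t) → ‖x 0‖ ≤ δ →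
      (∀ t, 0 ≤ t → x t ∈ X) → ∀ t, 0 ≤ t → ‖x t‖ ≤ ε := by
  have hnn : ∀ y, 0 ≤ φ y := fun y => by
    rcases eq_or_ne y 0 with rfl | hy
    exacts [hφ0.ge, (hpos y hy).le]
  obtain ⟨c, hc, hcφ⟩ := hX.exists_pos_le_of_le_norm hφ hpos (half_pos hε)
  obtain ⟨M₀, hM₀⟩ := hX.exists_bound_of_continuousOn hf.continuousOn
  obtain ⟨M, hM, hfM⟩ : ∃ M > 0, ∀ y ∈ X, ‖f y‖ ≤ M :=
    ⟨max M₀ 1, by positivity, fun y hy => (hM₀ y hy).trans (le_max_left _ _)⟩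
  obtain ⟨τ, hτ, hτM⟩ : ∃ τ > 0, M * τ = ε / 2 := ⟨ε / 2 / M, by positivity, by field_simp⟩
  obtain ⟨r, hr, hball⟩ := Metric.eventually_nhds_iff.1
    (hV.continuous.continuousAt.eventually (gt_mem_nhds (lt_add_of_pos_right _ (mul_pos hc hτ))) :
      ∀ᶠ y in nhds 0, V y < V 0 + c * τ)
  refine ⟨r / 2, half_pos hr, fun x hx hx0 hxX t ht => ?_⟩
  by_contra! hlt
  have hstart := hball (y := x 0) (by rw [dist_zero_right]; linarith)
  have hdrop₁ := le_sub_of_lyapunov_derivative_le (c := 0) hV ht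
    (fun s hs => hx s hs.1) (fun s hs => by linarith [hdec _ (hxX s hs.1), hnn (x s)])
  have hfar : ∀ s ∈ Set.Icc t (t + τ), ε / 2 ≤ ‖x s‖ := fun s hs => by
    have h1 : ‖x s - x t‖ ≤ M * ‖s - t‖ :=
      (convex_Icc t (t + τ)).norm_image_sub_le_of_norm_hasDerivWithin_le
        (fun u hu => (hx u (ht.trans hu.1)).hasDerivWithinAt)
        (fun u hu => hfM _ (hxX u (ht.trans hu.1)))
        (Set.left_mem_Icc.2 (by linarith)) hs
    rw [Real.norm_of_nonneg (by linarith [hs.1])] at h1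
    have h2 : M * (s - t) ≤ M * τ := by gcongr; linarith [hs.2]
    have h3 : ‖x t‖ - ‖x s‖ ≤ ‖x s - x t‖ := by
      rw [norm_sub_rev]; exact norm_sub_norm_le _ _
    linarith
  have hdrop₂ := le_sub_of_lyapunov_derivative_le (c := c) hV (le_add_of_nonneg_right hτ.le)
    (fun s hs => hx s (ht.trans hs.1)) (fun s hs => by
      linarith [hdec _ (hxX s (ht.trans hs.1)), hcφ _ (hxX s (ht.trans hs.1)) (hfar s hs)])
  have hzero := lyapunov_zero_le_of_forall_mem hX hV hφ hφ0 hpos hdec hx hxX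
    (add_nonneg ht hτ.le)
  rw [add_sub_cancel_left] at hdrop₂
  linarith

lemma IsPolyFun.differentiable {n : ℕ} {g : (Fin n → ℝ) → ℝ} (hg : IsPolyFun g) :
    Differentiable ℝ g := by
  obtain ⟨q, hq⟩ := hg
  obtain rfl : g = fun x => MvPolynomial.eval x q := funext hq
  clear hq
  induction q using MvPolynomial.induction_on with
  | C a => simp
  | add p q hp hq =>
    simp only [map_add]
    exact hp.fun_add hq
  | mul_X p i hp =>
    simp only [map_mul, MvPolynomial.eval_X]
    exact hp.fun_mul (differentiable_apply i)

lemma fderiv_apply_eq_sum_pder {n : ℕ} {g : (Fin n → ℝ) → ℝ} {x : Fin n → ℝ}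
    (hg : DifferentiableAt ℝ g x) (v : Fin n → ℝ) :
    fderiv ℝ g x v = ∑ i, pder i g x * v i := by
  have hp : ∀ i, pder i g x = fderiv ℝ g x (Pi.single i 1) := fun i => by
    refine HasDerivAt.deriv ?_
    refine HasFDerivAt.comp_hasDerivAt (x i) ?_ (hasDerivAt_update x i (x i))
    rw [Function.update_eq_self]
    exact hg.hasFDerivAt
  conv_lhs => rw [pi_eq_sum_univ' v]
  simp [hp, mul_comm]

/-- **Bernstein-certificate criterion for local stability** on `X = [-1/2,1/2]ⁿ`. -/
theorem bernstein_certificate_local_stability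
    {n : ℕ}
    (f : (Fin n → ℝ) → (Fin n → ℝ))
    (hf : Continuous f) (hf0 : f 0 = 0)
    -- Bernstein approximations of the components of `f`, with prescribed degrees
    (μ : Fin n → Fin n → ℕ) (hμ : ∀ i j, 0 < μ i j)
    (ebar : Fin n → ℝ) (hebar : ∀ i, 0 ≤ ebar i)
    (hfb : ∀ i, ∀ x : Fin n → ℝ, (∀ j, |x j| ≤ 1 / 2) →
      |f x i - bernShift (μ i) (fun a => f a i) x| ≤ ebar i)
    -- the Lyapunov candidate, positive definite polynomials and multipliers
    (V : (Fin n → ℝ) → ℝ) (hV : IsPolyFun V)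
    (φ₁ φ₂ : (Fin n → ℝ) → ℝ)
    (hφ₁ : IsPolyFun φ₁ ∧ IsPosDef φ₁) (hφ₂ : IsPolyFun φ₂ ∧ IsPosDef φ₂)
    (s₁ s₂ s₃ s₄ s₅ s₆ : Fin n → (Fin n → ℝ) → ℝ)
    (hs₁ : ∀ i, IsPolyFun (s₁ i) ∧ ∀ x, 0 ≤ s₁ i x)
    (hs₂ : ∀ i, IsPolyFun (s₂ i) ∧ ∀ x, 0 ≤ s₂ i x)
    (hs₃ : ∀ i, IsPolyFun (s₃ i) ∧ ∀ x, 0 ≤ s₃ i x)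
    (hs₄ : ∀ i, IsPolyFun (s₄ i) ∧ ∀ x, 0 ≤ s₄ i x)
    (hs₅ : ∀ i, IsPolyFun (s₅ i) ∧ ∀ x, 0 ≤ s₅ i x)
    (hs₆ : ∀ i, IsPolyFun (s₆ i) ∧ ∀ x, 0 ≤ s₆ i x)
    -- certificate condition (a)
    (ha : ∀ x : Fin n → ℝ,
      0 ≤ V x - φ₁ x + ∑ i, (s₁ i x * (x i - 1 / 2) - s₂ i x * (x i + 1 / 2)))
    -- certificate condition (b)
    (hb : ∀ (x : Fin n → ℝ) (ε : Fin n → ℝ),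
      0 ≤
        (∑ i, (-(pder i V x) * (bernShift (μ i) (fun a => f a i) x + ε i) +
            s₃ i x * (ε i - ebar i) - s₄ i x * (ε i + ebar i) +
            s₅ i x * (x i - 1 / 2) - s₆ i x * (x i + 1 / 2))) - φ₂ x) :
    -- conclusion: Lyapunov stability of the origin relative to `X`
    ∀ ε > (0 : ℝ), ∃ δ > (0 : ℝ),
      ∀ xtr : ℝ → (Fin n → ℝ),
        (∀ t : ℝ, 0 ≤ t → HasDerivAt xtr (f (xtr t)) t) →
        ‖xtr 0‖ ≤ δ →
        (∀ t : ℝ, 0 ≤ t → ∀ j, |xtr t j| ≤ 1 / 2) →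
        ∀ t : ℝ, 0 ≤ t → ‖xtr t‖ ≤ ε := by
  intro ε hε
  have hmem : ∀ x : Fin n → ℝ, x ∈ Metric.closedBall 0 (1 / 2 : ℝ) ↔ ∀ j, |x j| ≤ 1 / 2 :=
    fun x => by
      rw [mem_closedBall_zero_iff, pi_norm_le_iff_of_nonneg (by norm_num)]
      simp only [Real.norm_eq_abs]
  have hdec : ∀ x ∈ Metric.closedBall (0 : Fin n → ℝ) (1 / 2 : ℝ),
      fderiv ℝ V x (f x) ≤ -φ₂ x := fun x hx => by
    rw [hmem] at hx
    have hcert := hb x (fun i => f x i - bernShift (μ i) (fun a => f a i) x)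
    rw [fderiv_apply_eq_sum_pder (hV.differentiable x)]
    have hle := Finset.sum_le_sum (s := Finset.univ) fun i _ =>
      (show -(pder i V x) * (bernShift (μ i) (fun a => f a i) x +
            (f x i - bernShift (μ i) (fun a => f a i) x)) +
          s₃ i x * ((f x i - bernShift (μ i) (fun a => f a i) x) - ebar i) -
          s₄ i x * ((f x i - bernShift (μ i) (fun a => f a i) x) + ebar i) +
          s₅ i x * (x i - 1 / 2) - s₆ i x * (x i + 1 / 2) ≤ -(pder i V x * f x i) by
        obtain ⟨h1, h2⟩ := abs_le.1 (hfb i x hx)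
        obtain ⟨h3, h4⟩ := abs_le.1 (hx i)
        have := mul_nonneg ((hs₃ i).2 x) (sub_nonneg.2 h2)
        have := mul_nonneg ((hs₄ i).2 x) (sub_nonneg.2 h1)
        have := mul_nonneg ((hs₅ i).2 x) (sub_nonneg.2 h4)
        have := mul_nonneg ((hs₆ i).2 x) (sub_nonneg.2 h3)
        linarith)
    rw [Finset.sum_neg_distrib] at hle
    linarith
  simpa only [hmem] using lyapunov_stable_of_forall_mem (isCompact_closedBall _ _) hf
    hV.differentiable hφ₂.1.differentiable.continuous hφ₂.2.1 hφ₂.2.2 hdec hε
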